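/- Let f, r : ℝ → ℝ be of class C², let B > 0, and set R₁(B) = sup_{|s|≤B} |r'(s)|, F₁(B) = sup_{|s|≤B} |f'(s)|, and γ = 2R₁(B) + F₁(B)². Let y be a classical solution of y_t + (f(y))_x = y_xx + r(y) on [0,1] × (0,τ] with homogeneous Dirichlet boundary conditions satisfying |y(x,t)| ≤ B, and let p be a classical solution on [0,1] × [0,τ] of the backward adjoint equation −p_t − f'(y) p_x = p_xx + r'(y) p with homogeneous Dirichlet boundary conditions. Then ∫₀^τ ‖p_x(·,t)‖² dt ≤ e^{γτ} ‖p(·,τ)‖², where ‖·‖ denotes the L²(0,1) norm and p_x is the spatial derivative of p. -/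

import Mathlib

open Set MeasureTheory intervalIntegral

/-- `y` is a classical solution of `y_t + (f(y))_x = y_xx + r(y)` on `[0,1] × (0,τ]`
with homogeneous Dirichlet boundary conditions. -/
def IsClassicalSolutionOnIoc (f r : ℝ → ℝ) (τ : ℝ) (y : ℝ → ℝ → ℝ) : Prop :=
  ContinuousOn (fun pt : ℝ × ℝ => y pt.1 pt.2) (Icc 0 1 ×ˢ Icc 0 τ) ∧
  (∀ t ∈ Ioc (0:ℝ) τ, ContDiffOn ℝ 2 (fun x => y x t) (Icc 0 1)) ∧
  (∀ t ∈ Icc (0:ℝ) τ, y 0 t = 0 ∧ y 1 t = 0) ∧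
  (∀ x ∈ Ioo (0:ℝ) 1, ∀ t ∈ Ioc (0:ℝ) τ,
    HasDerivWithinAt (fun s => y x s)
      (deriv (deriv (fun x' => y x' t)) x - deriv (fun x' => f (y x' t)) x + r (y x t))
      (Iic τ) t)

/-- `p` is a classical solution of the backward adjoint equation
`−p_t − f'(y) p_x = p_xx + r'(y) p` on `[0,1] × [0,τ]` with homogeneous Dirichlet
boundary conditions. -/
def IsAdjointSolutionOn (f r : ℝ → ℝ) (y : ℝ → ℝ → ℝ) (τ : ℝ) (p : ℝ → ℝ → ℝ) : Prop :=
  ContinuousOn (fun pt : ℝ × ℝ => p pt.1 pt.2) (Icc 0 1 ×ˢ Icc 0 τ) ∧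
  (∀ t ∈ Icc (0:ℝ) τ, ContDiffOn ℝ 2 (fun x => p x t) (Icc 0 1)) ∧
  (∀ t ∈ Icc (0:ℝ) τ, p 0 t = 0 ∧ p 1 t = 0) ∧
  (∀ x ∈ Ioo (0:ℝ) 1, ∀ t ∈ Icc (0:ℝ) τ,
    HasDerivWithinAt (fun s => p x s)
      (-(deriv (deriv (fun x' => p x' t)) x) - deriv f (y x t) * deriv (fun x' => p x' t) x
        - deriv r (y x t) * p x t) (Icc 0 τ) t)


open Topology Filter

/-- At a local maximum where the function is continuous, the second derivative is nonpositive. -/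
theorem IsLocalMax.deriv_deriv_nonpos {u : ℝ → ℝ} {x : ℝ} (h : IsLocalMax u x)
    (hc : ContinuousAt u x) : deriv (deriv u) x ≤ 0 := by
  by_contra! hpos
  have hmin := isLocalMin_of_deriv_deriv_pos hpos h.deriv_eq_zero hc
  have hconst : u =ᶠ[𝓝 x] fun _ => u x := by
    filter_upwards [h, hmin] with z hz hz' using le_antisymm hz hz'
  have := hconst.deriv.deriv_eq
  simp at this
  exact hpos.ne' this

/-- A right derivative is nonpositive at a point which dominates the values to its right. -/
theorem HasDerivWithinAt.nonpos_of_le_right {v : ℝ → ℝ} {d s b : ℝ} (hsb : s < b)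
    (hv : HasDerivWithinAt v d (Ioi s) s) (hle : ∀ t ∈ Ioo s b, v t ≤ v s) : d ≤ 0 := by
  refine le_of_tendsto ((hasDerivWithinAt_iff_tendsto_slope' self_notMem_Ioi).mp hv) ?_
  filter_upwards [Ioo_mem_nhdsGT hsb] with t ht
  rw [slope_def_field]
  exact div_nonpos_of_nonpos_of_nonneg (by linarith [hle t ht]) (by linarith [ht.1])

/-- If `φ` is bounded above by the left derivative of `g`, then `∫ φ ≤ g b - g a`. -/
theorem integral_le_sub_of_hasDeriv_left_of_le {g g' φ : ℝ → ℝ} {b : ℝ} (hb : 0 ≤ b)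
    (hcont : ContinuousOn g (Icc 0 b))
    (hderiv : ∀ t ∈ Ioo 0 b, HasDerivWithinAt g (g' t) (Iio t) t)
    (hφ : IntegrableOn φ (Icc 0 b)) (hle : ∀ t ∈ Ioo 0 b, φ t ≤ g' t) :
    ∫ t in (0:ℝ)..b, φ t ≤ g b - g 0 := by
  have hmaps : MapsTo (fun s => b - s) (Icc 0 b) (Icc 0 b) := fun s hs =>
    ⟨by linarith [hs.2], by linarith [hs.1]⟩
  have hint : IntegrableOn (fun s => φ (b - s)) (Icc 0 b) := by
    rw [integrableOn_Icc_iff_integrableOn_Ioc, ← intervalIntegrable_iff_integrableOn_Ioc_of_le hb]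
    rw [integrableOn_Icc_iff_integrableOn_Ioc,
      ← intervalIntegrable_iff_integrableOn_Ioc_of_le hb] at hφ
    simpa using (hφ.comp_sub_left b).symm
  have key := integral_le_sub_of_hasDeriv_right_of_le (g := fun s => -g (b - s))
    (g' := fun s => g' (b - s)) (φ := fun s => φ (b - s)) hb
    ((hcont.comp (by fun_prop) hmaps).neg) (fun s hs => ?_) hint
    (fun s hs => hle _ ⟨by linarith [hs.2], by linarith [hs.1]⟩)
  · rw [intervalIntegral.integral_comp_sub_left φ b] at key
    simp only [sub_self, sub_zero] at key
    linarith
  · have h1 := hderiv (b - s) ⟨by linarith [hs.2], by linarith [hs.1]⟩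
    have h2 : HasDerivWithinAt (fun s => b - s) (-1) (Ioi s) s :=
      ((hasDerivAt_id s).const_sub b).hasDerivWithinAt
    have h3 := (h1.comp s h2 (fun z hz => by
      simp only [mem_Ioi, mem_Iio] at hz ⊢; linarith)).neg
    refine h3.congr_deriv ?_
    ring

/-- The first two derivatives of a `C²` function on `[0,1]` extend continuously to `[0,1]`. -/
theorem ContDiffOn.exists_continuousOn_deriv_deriv {g : ℝ → ℝ}
    (hg : ContDiffOn ℝ 2 g (Icc 0 1)) :
    ∃ g₁ g₂ : ℝ → ℝ, ContinuousOn g₁ (Icc 0 1) ∧ ContinuousOn g₂ (Icc 0 1) ∧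
      ∀ x ∈ Ioo (0:ℝ) 1, HasDerivAt g (g₁ x) x ∧ HasDerivAt g₁ (g₂ x) x ∧
        deriv g x = g₁ x ∧ deriv (deriv g) x = g₂ x := by
  have hu : UniqueDiffOn ℝ (Icc (0:ℝ) 1) := uniqueDiffOn_Icc zero_lt_one
  have h1 : ContDiffOn ℝ 1 (derivWithin g (Icc 0 1)) (Icc 0 1) :=
    hg.derivWithin hu (by norm_num)
  have h2 : ContDiffOn ℝ 0 (derivWithin (derivWithin g (Icc 0 1)) (Icc 0 1)) (Icc 0 1) :=
    h1.derivWithin hu (by norm_num)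
  refine ⟨_, _, h1.continuousOn, h2.continuousOn, fun x hx => ?_⟩
  have hd : ∀ z ∈ Ioo (0:ℝ) 1, HasDerivAt g (derivWithin g (Icc 0 1) z) z := fun z hz =>
    ((hg.differentiableOn (by norm_num) z (Ioo_subset_Icc_self hz)).hasDerivWithinAt).hasDerivAt
      (Icc_mem_nhds hz.1 hz.2)
  have hd2 : HasDerivAt (derivWithin g (Icc 0 1))
      (derivWithin (derivWithin g (Icc 0 1)) (Icc 0 1) x) x :=
    ((h1.differentiableOn (by norm_num) x (Ioo_subset_Icc_self hx)).hasDerivWithinAt).hasDerivAt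
      (Icc_mem_nhds hx.1 hx.2)
  refine ⟨hd x hx, hd2, (hd x hx).deriv, ?_⟩
  have : deriv g =ᶠ[𝓝 x] derivWithin g (Icc 0 1) := by
    filter_upwards [Ioo_mem_nhds hx.1 hx.2] with z hz using (hd z hz).deriv
  rw [this.deriv_eq, hd2.deriv]

namespace IsAdjointSolutionOn

variable {f r : ℝ → ℝ} {y p : ℝ → ℝ → ℝ} {τ F R : ℝ}

theorem neg (hp : IsAdjointSolutionOn f r y τ p) :
    IsAdjointSolutionOn f r y τ (fun x t => -p x t) := by
  obtain ⟨h1, h2, h3, h4⟩ := hp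
  refine ⟨h1.neg, fun t ht => (h2 t ht).neg, fun t ht => by simp [h3 t ht], fun x hx t ht => ?_⟩
  refine (h4 x hx t ht).fun_neg.congr_deriv ?_
  have : deriv (fun x' => -p x' t) = fun z => -deriv (fun x' => p x' t) z := by
    funext z; exact deriv.fun_neg
  rw [this, deriv.fun_neg]
  ring

theorem exists_bound (hp : IsAdjointSolutionOn f r y τ p) :
    ∃ M, ∀ x ∈ Icc (0:ℝ) 1, ∀ t ∈ Icc (0:ℝ) τ, |p x t| ≤ M := by
  obtain ⟨M, hM⟩ := (isCompact_Icc.prod isCompact_Icc).exists_bound_of_continuousOn hp.1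
  exact ⟨M, fun x hx t ht => hM (x, t) ⟨hx, ht⟩⟩

theorem continuousOn_left (hp : IsAdjointSolutionOn f r y τ p) {t : ℝ} (ht : t ∈ Icc 0 τ) :
    ContinuousOn (fun x => p x t) (Icc 0 1) :=
  hp.1.comp (f := fun x => (x, t)) (by fun_prop) (fun _ hx => ⟨hx, ht⟩)

/-- By the maximum principle, `p` exceeds its value at time `t₀` at most linearly in the time
elapsed, uniformly in space. -/
theorem exists_le_add_mul (hp : IsAdjointSolutionOn f r y τ p)
    (hF : ∀ x ∈ Icc (0:ℝ) 1, ∀ t ∈ Icc (0:ℝ) τ, |deriv f (y x t)| ≤ F)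
    (hR : ∀ x ∈ Icc (0:ℝ) 1, ∀ t ∈ Icc (0:ℝ) τ, |deriv r (y x t)| ≤ R)
    {t₀ : ℝ} (ht₀ : t₀ ∈ Icc 0 τ) :
    ∃ C, 0 ≤ C ∧ ∀ t ∈ Icc 0 t₀, ∀ x ∈ Icc (0:ℝ) 1, p x t ≤ p x t₀ + C * (t₀ - t) := by
  obtain ⟨M, hM⟩ := hp.exists_bound
  obtain ⟨hc, h2, h3, h4⟩ := hp
  obtain ⟨g₁, g₂, hg₁, hg₂, hg⟩ := (h2 t₀ ht₀).exists_continuousOn_deriv_deriv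
  obtain ⟨K₁, hK₁⟩ := isCompact_Icc.exists_bound_of_continuousOn hg₁
  obtain ⟨K₂, hK₂⟩ := isCompact_Icc.exists_bound_of_continuousOn hg₂
  simp only [Real.norm_eq_abs] at hK₁ hK₂
  have h01 : (0:ℝ) ∈ Icc (0:ℝ) 1 := ⟨le_rfl, zero_le_one⟩
  have hF0 : 0 ≤ F := (abs_nonneg _).trans (hF 0 h01 t₀ ht₀)
  have hR0 : 0 ≤ R := (abs_nonneg _).trans (hR 0 h01 t₀ ht₀)
  have hM0 : 0 ≤ M := (abs_nonneg _).trans (hM 0 h01 t₀ ht₀)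
  have hK₁0 : 0 ≤ K₁ := (abs_nonneg _).trans (hK₁ 0 h01)
  have hK₂0 : 0 ≤ K₂ := (abs_nonneg _).trans (hK₂ 0 h01)
  obtain ⟨C, hC⟩ : ∃ C, C = K₂ + F * K₁ + R * M + 1 := ⟨_, rfl⟩
  have hC0 : 0 ≤ C := by rw [hC]; positivity
  refine ⟨C, hC0, ?_⟩
  have hsub : Icc 0 t₀ ⊆ Icc 0 τ := Icc_subset_Icc_right ht₀.2
  have hucont : ContinuousOn (fun q : ℝ × ℝ => p q.1 q.2 - p q.1 t₀ - C * (t₀ - q.2))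
      (Icc 0 1 ×ˢ Icc 0 t₀) := by
    refine ((hc.mono (prod_mono_right hsub)).sub ?_).sub (by fun_prop)
    exact hc.comp (f := fun q : ℝ × ℝ => (q.1, t₀)) (by fun_prop) (fun q hq => ⟨hq.1, ht₀⟩)
  obtain ⟨⟨x, t⟩, ⟨hx, ht⟩, hmax⟩ := (isCompact_Icc.prod isCompact_Icc).exists_isMaxOn
    ⟨((0:ℝ), t₀), h01, ht₀.1, le_rfl⟩ hucont
  simp only at hx ht
  have hmax' : ∀ x' ∈ Icc (0:ℝ) 1, ∀ t' ∈ Icc (0:ℝ) t₀,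
      p x' t' - p x' t₀ - C * (t₀ - t') ≤ p x t - p x t₀ - C * (t₀ - t) :=
    fun x' hx' t' ht' => hmax (a := (x', t')) ⟨hx', ht'⟩
  suffices p x t - p x t₀ - C * (t₀ - t) ≤ 0 by
    intro t' ht' x' hx'
    linarith [hmax' x' hx' t' ht']
  by_contra! hpos
  have htlt : t < t₀ := by
    refine lt_of_le_of_ne ht.2 fun h => ?_
    simp [h] at hpos
  have hCt : 0 ≤ C * (t₀ - t) := mul_nonneg hC0 (by linarith)
  have hxI : x ∈ Ioo (0:ℝ) 1 := by
    refine ⟨lt_of_le_of_ne hx.1 fun h => ?_, lt_of_le_of_ne hx.2 fun h => ?_⟩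
    · rw [← h, (h3 t (hsub ht)).1, (h3 t₀ ht₀).1] at hpos
      linarith
    · rw [h, (h3 t (hsub ht)).2, (h3 t₀ ht₀).2] at hpos
      linarith
  obtain ⟨k₁, k₂, -, -, hk⟩ := (h2 t (hsub ht)).exists_continuousOn_deriv_deriv
  have hnhds : Ioo (0:ℝ) 1 ∈ 𝓝 x := Ioo_mem_nhds hxI.1 hxI.2
  have hlm : IsLocalMax (fun x' => p x' t - p x' t₀) x := by
    filter_upwards [hnhds] with x' hx'
    linarith [hmax' x' (Ioo_subset_Icc_self hx') t ht]
  have hd1 : ∀ z ∈ Ioo (0:ℝ) 1, HasDerivAt (fun x' => p x' t - p x' t₀) (k₁ z - g₁ z) z :=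
    fun z hz => (hk z hz).1.fun_sub (hg z hz).1
  have hd2 : deriv (deriv fun x' => p x' t - p x' t₀) x = k₂ x - g₂ x := by
    have : (deriv fun x' => p x' t - p x' t₀) =ᶠ[𝓝 x] fun z => k₁ z - g₁ z := by
      filter_upwards [hnhds] with z hz using (hd1 z hz).deriv
    rw [this.deriv_eq, ((hk x hxI).2.1.fun_sub (hg x hxI).2.1).deriv]
  have hk₁ : k₁ x = g₁ x := by
    have := hlm.hasDerivAt_eq_zero (hd1 x hxI)
    linarith
  have hk₂ : k₂ x ≤ g₂ x := by
    have := hlm.deriv_deriv_nonpos (hd1 x hxI).continuousAt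
    rw [hd2] at this
    linarith
  have hpt := h4 x hxI t (hsub ht)
  rw [(hk x hxI).2.2.1, (hk x hxI).2.2.2, hk₁] at hpt
  have hpt' := (hpt.mono_of_mem_nhdsWithin
    (Icc_mem_nhdsGT_of_mem ⟨ht.1, htlt.trans_le ht₀.2⟩)).fun_add
    (((hasDerivAt_id t).const_mul C).hasDerivWithinAt (s := Ioi t))
  have hle := hpt'.nonpos_of_le_right htlt (fun s hs => by
    have := hmax' x hx s ⟨ht.1.trans hs.1.le, hs.2.le⟩
    simp only [id]
    linarith)
  have e1 : deriv f (y x t) * g₁ x ≤ F * K₁ :=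
    (le_abs_self _).trans (by
      rw [abs_mul]; exact mul_le_mul (hF x hx t (hsub ht)) (hK₁ x hx) (abs_nonneg _) hF0)
  have e2 : deriv r (y x t) * p x t ≤ R * M :=
    (le_abs_self _).trans (by
      rw [abs_mul]
      exact mul_le_mul (hR x hx t (hsub ht)) (hM x hx t (hsub ht)) (abs_nonneg _) hR0)
  have e3 := (le_abs_self _).trans (hK₂ x hx)
  linarith

/-- At every time, `p` is left-Lipschitz in time, uniformly in space. -/
theorem exists_abs_sub_le (hp : IsAdjointSolutionOn f r y τ p)
    (hF : ∀ x ∈ Icc (0:ℝ) 1, ∀ t ∈ Icc (0:ℝ) τ, |deriv f (y x t)| ≤ F)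
    (hR : ∀ x ∈ Icc (0:ℝ) 1, ∀ t ∈ Icc (0:ℝ) τ, |deriv r (y x t)| ≤ R)
    {t₀ : ℝ} (ht₀ : t₀ ∈ Icc 0 τ) :
    ∃ C, 0 ≤ C ∧ ∀ t ∈ Icc 0 t₀, ∀ x ∈ Icc (0:ℝ) 1, |p x t - p x t₀| ≤ C * (t₀ - t) := by
  obtain ⟨C, hC0, hC⟩ := hp.exists_le_add_mul hF hR ht₀
  obtain ⟨C', -, hC'⟩ := hp.neg.exists_le_add_mul hF hR ht₀
  refine ⟨max C C', hC0.trans (le_max_left _ _), fun t ht x hx => ?_⟩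
  have h1 := mul_le_mul_of_nonneg_right (le_max_left C C') (sub_nonneg.mpr ht.2)
  have h2 := mul_le_mul_of_nonneg_right (le_max_right C C') (sub_nonneg.mpr ht.2)
  rw [abs_le]
  constructor <;> linarith [hC t ht x hx, hC' t ht x hx]

theorem continuousOn_integral_sq (hp : IsAdjointSolutionOn f r y τ p) :
    ContinuousOn (fun t => ∫ x in (0:ℝ)..1, p x t ^ 2) (Icc 0 τ) := by
  obtain ⟨M, hM⟩ := hp.exists_bound
  intro t ht
  refine continuousWithinAt_of_dominated_interval (bound := fun _ => M ^ 2) ?_ ?_ (by simp) ?_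
  · filter_upwards [self_mem_nhdsWithin] with s hs
    rw [uIoc_of_le zero_le_one]
    exact (((hp.continuousOn_left hs).pow 2).mono Ioc_subset_Icc_self).aestronglyMeasurable
      measurableSet_Ioc
  · filter_upwards [self_mem_nhdsWithin] with s hs
    refine ae_of_all _ fun x hx => ?_
    rw [uIoc_of_le zero_le_one] at hx
    rw [Real.norm_eq_abs, abs_of_nonneg (sq_nonneg _), ← sq_abs]
    exact pow_le_pow_left₀ (abs_nonneg _) (hM x (Ioc_subset_Icc_self hx) s hs) 2
  · refine ae_of_all _ fun x hx => ?_
    rw [uIoc_of_le zero_le_one] at hx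
    have : ContinuousOn (fun s => p x s) (Icc 0 τ) :=
      hp.1.comp (f := fun s => (x, s)) (by fun_prop) (fun s hs => ⟨Ioc_subset_Icc_self hx, hs⟩)
    exact (this t ht).pow 2

/-- The energy has the expected left derivative at every positive time. -/
theorem hasDerivWithinAt_integral_sq (hp : IsAdjointSolutionOn f r y τ p)
    (hF : ∀ x ∈ Icc (0:ℝ) 1, ∀ t ∈ Icc (0:ℝ) τ, |deriv f (y x t)| ≤ F)
    (hR : ∀ x ∈ Icc (0:ℝ) 1, ∀ t ∈ Icc (0:ℝ) τ, |deriv r (y x t)| ≤ R)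
    {t : ℝ} (ht : t ∈ Ioc 0 τ) {q : ℝ → ℝ}
    (hq : ∀ x ∈ Ioo (0:ℝ) 1, HasDerivWithinAt (fun s => p x s) (q x) (Icc 0 τ) t) :
    HasDerivWithinAt (fun s => ∫ x in (0:ℝ)..1, p x s ^ 2)
      (∫ x in (0:ℝ)..1, 2 * p x t * q x) (Iio t) t := by
  have ht' : t ∈ Icc 0 τ := Ioc_subset_Icc_self ht
  obtain ⟨M, hM⟩ := hp.exists_bound
  obtain ⟨C, hC0, hC⟩ := hp.exists_abs_sub_le hF hR ht'
  have hM0 : 0 ≤ M := (abs_nonneg _).trans (hM 0 ⟨le_rfl, zero_le_one⟩ t ht')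
  have hcont : ∀ s ∈ Icc 0 τ, ContinuousOn (fun x => p x s ^ 2) (Icc 0 1) := fun s hs =>
    (hp.continuousOn_left hs).pow 2
  have hII : ∀ s ∈ Icc 0 τ, IntervalIntegrable (fun x => p x s ^ 2) volume 0 1 := fun s hs =>
    (hcont s hs).intervalIntegrable_of_Icc zero_le_one
  rw [hasDerivWithinAt_iff_tendsto_slope' self_notMem_Iio]
  have hmem : ∀ᶠ s in 𝓝[<] t, s ∈ Ico 0 t := Ico_mem_nhdsLT ht.1
  have hslope : ∀ᶠ s in 𝓝[<] t,
      (∫ x in (0:ℝ)..1, (p x s ^ 2 - p x t ^ 2) / (s - t)) =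
        slope (fun s => ∫ x in (0:ℝ)..1, p x s ^ 2) t s := by
    filter_upwards [hmem] with s hs
    rw [slope_def_field, intervalIntegral.integral_div,
      intervalIntegral.integral_sub (hII s ⟨hs.1, hs.2.le.trans ht.2⟩) (hII t ht')]
  refine Tendsto.congr' hslope ?_
  refine intervalIntegral.tendsto_integral_filter_of_dominated_convergence
    (fun _ => C * (2 * M)) ?_ ?_ (by simp) ?_
  · filter_upwards [hmem] with s hs
    rw [uIoc_of_le zero_le_one]
    exact ((((hcont s ⟨hs.1, hs.2.le.trans ht.2⟩).sub (hcont t ht')).div_const _).mono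
      Ioc_subset_Icc_self).aestronglyMeasurable measurableSet_Ioc
  · filter_upwards [hmem] with s hs
    refine ae_of_all _ fun x hx => ?_
    rw [uIoc_of_le zero_le_one] at hx
    have hx' := Ioc_subset_Icc_self hx
    have hs' : s ∈ Icc 0 τ := ⟨hs.1, hs.2.le.trans ht.2⟩
    have hst : 0 < t - s := sub_pos.mpr hs.2
    rw [Real.norm_eq_abs, abs_div, abs_sub_comm s t, abs_of_pos hst, div_le_iff₀ hst,
      show p x s ^ 2 - p x t ^ 2 = (p x s - p x t) * (p x s + p x t) by ring, abs_mul]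
    calc |p x s - p x t| * |p x s + p x t| ≤ (C * (t - s)) * (2 * M) := by
          refine mul_le_mul (hC s ⟨hs.1, hs.2.le⟩ x hx') ?_ (abs_nonneg _) (by positivity)
          linarith [abs_add_le (p x s) (p x t), hM x hx' s hs', hM x hx' t ht']
      _ = C * (2 * M) * (t - s) := by ring
  · have hne : ∀ᵐ x : ℝ, x ≠ 1 := by simp [ae_iff]
    filter_upwards [hne] with x hx1 hx
    rw [uIoc_of_le zero_le_one] at hx
    have h := ((hq x ⟨hx.1, lt_of_le_of_ne hx.2 hx1⟩).mono_of_mem_nhdsWithin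
      (Icc_mem_nhdsLT_of_mem ht)).fun_pow 2
    rw [hasDerivWithinAt_iff_tendsto_slope' self_notMem_Iio] at h
    simp only [slope_fun_def_field] at h
    simpa using h

/-- The differential form of the energy estimate, before integrating in time. -/
theorem exists_hasDerivWithinAt_integral_sq_ge (hp : IsAdjointSolutionOn f r y τ p)
    (hf : Continuous (deriv f)) (hr : Continuous (deriv r))
    (hy : ContinuousOn (fun q : ℝ × ℝ => y q.1 q.2) (Icc 0 1 ×ˢ Icc 0 τ))
    (hF : ∀ x ∈ Icc (0:ℝ) 1, ∀ t ∈ Icc (0:ℝ) τ, |deriv f (y x t)| ≤ F)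
    (hR : ∀ x ∈ Icc (0:ℝ) 1, ∀ t ∈ Icc (0:ℝ) τ, |deriv r (y x t)| ≤ R)
    {t : ℝ} (ht : t ∈ Ioc 0 τ) :
    ∃ d, HasDerivWithinAt (fun s => ∫ x in (0:ℝ)..1, p x s ^ 2) d (Iio t) t ∧
      (∫ x in (0:ℝ)..1, deriv (fun x' => p x' t) x ^ 2) ≤
        d + (2 * R + F ^ 2) * ∫ x in (0:ℝ)..1, p x t ^ 2 := by
  have ht' : t ∈ Icc 0 τ := Ioc_subset_Icc_self ht
  obtain ⟨g₁, g₂, hg₁, hg₂, hg⟩ := (hp.2.1 t ht').exists_continuousOn_deriv_deriv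
  have hpc := hp.continuousOn_left ht'
  have hyc : ContinuousOn (fun x => y x t) (Icc 0 1) :=
    hy.comp (f := fun x => (x, t)) (by fun_prop) (fun _ hx => ⟨hx, ht'⟩)
  have hac : ContinuousOn (fun x => deriv f (y x t)) (Icc 0 1) := hf.comp_continuousOn hyc
  have hbc : ContinuousOn (fun x => deriv r (y x t)) (Icc 0 1) := hr.comp_continuousOn hyc
  refine ⟨_, hp.hasDerivWithinAt_integral_sq hF hR ht (q := fun x =>
    -g₂ x - deriv f (y x t) * g₁ x - deriv r (y x t) * p x t) (fun x hx => ?_), ?_⟩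
  · have := hp.2.2.2 x hx t ht'
    rwa [(hg x hx).2.2.1, (hg x hx).2.2.2] at this
  have hsq : (∫ x in (0:ℝ)..1, deriv (fun x' => p x' t) x ^ 2) = ∫ x in (0:ℝ)..1, g₁ x ^ 2 := by
    simp only [intervalIntegral.integral_of_le zero_le_one, integral_Ioc_eq_integral_Ioo]
    exact setIntegral_congr_fun measurableSet_Ioo fun x hx => by simp only [(hg x hx).2.2.1]
  have hibp : (∫ x in (0:ℝ)..1, p x t * g₂ x) = -∫ x in (0:ℝ)..1, g₁ x ^ 2 := by
    rw [intervalIntegral.integral_mul_deriv_eq_deriv_mul_of_hasDerivAt (u' := g₁) (v := g₁)]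
    · simp [hp.2.2.1 t ht', sq]
    · rwa [uIcc_of_le zero_le_one]
    · rwa [uIcc_of_le zero_le_one]
    · simpa using fun x h h' => (hg x ⟨h, h'⟩).1
    · simpa using fun x h h' => (hg x ⟨h, h'⟩).2.1
    · exact hg₁.intervalIntegrable_of_Icc zero_le_one
    · exact hg₂.intervalIntegrable_of_Icc zero_le_one
  have i1 : IntervalIntegrable (fun x => p x t * g₂ x) volume 0 1 :=
    (hpc.mul hg₂).intervalIntegrable_of_Icc zero_le_one
  have i2 : IntervalIntegrable (fun x => g₁ x ^ 2) volume 0 1 :=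
    (hg₁.pow 2).intervalIntegrable_of_Icc zero_le_one
  have i3 : IntervalIntegrable (fun x => p x t ^ 2) volume 0 1 :=
    (hpc.pow 2).intervalIntegrable_of_Icc zero_le_one
  have hmono : (∫ x in (0:ℝ)..1,
      ((-2) * (p x t * g₂ x) - g₁ x ^ 2 - (2 * R + F ^ 2) * p x t ^ 2)) ≤
      ∫ x in (0:ℝ)..1, 2 * p x t *
        (-g₂ x - deriv f (y x t) * g₁ x - deriv r (y x t) * p x t) := by
    refine intervalIntegral.integral_mono_on zero_le_one
      (((i1.const_mul _).sub i2).sub (i3.const_mul _)) ?_ fun x hx => ?_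
    · exact ((hpc.const_mul 2).mul ((hg₂.neg.sub (hac.mul hg₁)).sub
        (hbc.mul hpc))).intervalIntegrable_of_Icc zero_le_one
    · have h1 : deriv f (y x t) ^ 2 ≤ F ^ 2 := by
        rw [← sq_abs]; exact pow_le_pow_left₀ (abs_nonneg _) (hF x hx t ht') 2
      have h2 : deriv r (y x t) ≤ R := (le_abs_self _).trans (hR x hx t ht')
      nlinarith [sq_nonneg (g₁ x - deriv f (y x t) * p x t),
        mul_le_mul_of_nonneg_right h1 (sq_nonneg (p x t)),
        mul_le_mul_of_nonneg_right h2 (sq_nonneg (p x t))]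
  rw [intervalIntegral.integral_sub ((i1.const_mul _).sub i2) (i3.const_mul _),
    intervalIntegral.integral_sub (i1.const_mul _) i2, intervalIntegral.integral_const_mul,
    intervalIntegral.integral_const_mul, hibp] at hmono
  rw [hsq]
  linarith

end IsAdjointSolutionOn

/-- A continuous function is bounded in absolute value on a compact interval by its supremum. -/
theorem Continuous.abs_le_sSup_image_Icc {g : ℝ → ℝ} (hg : Continuous g) {B s : ℝ}
    (hs : |s| ≤ B) : |g s| ≤ sSup ((fun s => |g s|) '' Icc (-B) B) :=
  le_csSup (isCompact_Icc.image hg.abs).bddAbove ⟨s, abs_le.mp hs, rfl⟩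

/-- `∫₀^τ ‖p_x(·,t)‖² dt ≤ e^{γτ} ‖p(·,τ)‖²` with `γ = 2R₁(B) + F₁(B)²`. -/
theorem adjoint_px_integral_bound
    (f r : ℝ → ℝ) (hf : ContDiff ℝ 2 f) (hr : ContDiff ℝ 2 r)
    (B : ℝ) (hB : 0 < B)
    (τ : ℝ) (hτ : 0 < τ) (y p : ℝ → ℝ → ℝ)
    (hy : IsClassicalSolutionOnIoc f r τ y)
    (hyB : ∀ x ∈ Icc (0:ℝ) 1, ∀ t ∈ Icc (0:ℝ) τ, |y x t| ≤ B)
    (hp : IsAdjointSolutionOn f r y τ p) :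
    (∫ t in (0:ℝ)..τ, ∫ x in (0:ℝ)..1, (deriv (fun x' => p x' t) x) ^ 2) ≤
      Real.exp ((2 * sSup ((fun s => |deriv r s|) '' Icc (-B) B)
        + (sSup ((fun s => |deriv f s|) '' Icc (-B) B)) ^ 2) * τ) *
        ∫ x in (0:ℝ)..1, (p x τ) ^ 2 := by
  have hf' : Continuous (deriv f) := hf.continuous_deriv (by norm_num)
  have hr' : Continuous (deriv r) := hr.continuous_deriv (by norm_num)
  set F := sSup ((fun s => |deriv f s|) '' Icc (-B) B)
  set R := sSup ((fun s => |deriv r s|) '' Icc (-B) B)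
  have hF : ∀ x ∈ Icc (0:ℝ) 1, ∀ t ∈ Icc (0:ℝ) τ, |deriv f (y x t)| ≤ F :=
    fun x hx t ht => hf'.abs_le_sSup_image_Icc (hyB x hx t ht)
  have hR : ∀ x ∈ Icc (0:ℝ) 1, ∀ t ∈ Icc (0:ℝ) τ, |deriv r (y x t)| ≤ R :=
    fun x hx t ht => hr'.abs_le_sSup_image_Icc (hyB x hx t ht)
  have hR0 : 0 ≤ R :=
    (abs_nonneg _).trans (hr'.abs_le_sSup_image_Icc (s := 0) (by simpa using hB.le))
  set γ := 2 * R + F ^ 2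
  have hγ : 0 ≤ γ := by positivity
  have hE0 : ∀ s, 0 ≤ ∫ x in (0:ℝ)..1, p x s ^ 2 := fun s =>
    intervalIntegral.integral_nonneg zero_le_one fun x _ => sq_nonneg _
  by_cases hint : IntervalIntegrable
      (fun t => ∫ x in (0:ℝ)..1, deriv (fun x' => p x' t) x ^ 2) volume 0 τ
  swap
  · rw [intervalIntegral.integral_undef hint]
    exact mul_nonneg (Real.exp_pos _).le (hE0 τ)
  rw [intervalIntegrable_iff_integrableOn_Ioc_of_le hτ.le,
    ← integrableOn_Icc_iff_integrableOn_Ioc] at hint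
  have key : ∀ t ∈ Ioc 0 τ, _ := fun t ht =>
    hp.exists_hasDerivWithinAt_integral_sq_ge hf' hr' hy.1 hF hR ht
  choose! d hd hle using key
  have hexp : ∀ t, HasDerivAt (fun t => Real.exp (γ * t)) (Real.exp (γ * t) * γ) t := fun t => by
    simpa using ((hasDerivAt_id t).const_mul γ).exp
  have main := integral_le_sub_of_hasDeriv_left_of_le
    (g := fun t => Real.exp (γ * t) * ∫ x in (0:ℝ)..1, p x t ^ 2) hτ.le
    (ContinuousOn.mul (by fun_prop) hp.continuousOn_integral_sq)
    (fun t ht => (hexp t).hasDerivWithinAt.fun_mul (hd t (Ioo_subset_Ioc_self ht)))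
    hint (fun t ht => ?_)
  · refine main.trans ?_
    linarith [mul_nonneg (Real.exp_pos (γ * 0)).le (hE0 0)]
  · have h1 := hle t (Ioo_subset_Ioc_self ht)
    have h2 : 1 ≤ Real.exp (γ * t) := Real.one_le_exp (mul_nonneg hγ ht.1.le)
    have h3 : 0 ≤ ∫ x in (0:ℝ)..1, deriv (fun x' => p x' t) x ^ 2 :=
      intervalIntegral.integral_nonneg zero_le_one fun x _ => sq_nonneg _
    nlinarith [mul_le_mul_of_nonneg_left h1 (Real.exp_pos (γ * t)).le,
      mul_le_mul_of_nonneg_right h2 h3]
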